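/- For every δ > 0 and every φ ∈ C([−h,0],ℝ^n) with ‖φ‖_H ≤ δ one has v(φ) ≤ b_1 ‖φ(0)‖_{r,p}^γ + b_2 ∫_{−h}^{0} ‖φ(θ)‖_{r,p}^{γ} dθ, where b_1 = α_1 + 2h(Σ_{i=1}^n β_i m_i) δ^μ and b_2 = (w_1 + h w_2 + Σ_{i=1}^n β_i m_i) δ^μ. -/

import Mathlib

set_option linter.unusedVariables false

noncomputable def hnorm (n : ℕ) (r : Fin n → ℝ) (p : ℝ) (x : Fin n → ℝ) : ℝ :=
  (∑ i, |x i| ^ (p / r i)) ^ (1 / p)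

noncomputable def pd (n : ℕ) (f : (Fin n → ℝ) → (Fin n → ℝ) → (Fin n → ℝ))
    (i j : Fin n) (x y : Fin n → ℝ) : ℝ :=
  deriv (fun t => f (Function.update x j t) y i) (x j)

noncomputable def vfun (n : ℕ) (r : Fin n → ℝ) (p h μ γ w1 w2 : ℝ)
    (f : (Fin n → ℝ) → (Fin n → ℝ) → (Fin n → ℝ)) (V : (Fin n → ℝ) → ℝ)
    (φ : ℝ → Fin n → ℝ) : ℝ :=
  V (φ 0) + fderiv ℝ V (φ 0) (∫ θ in (-h)..(0:ℝ), f (φ 0) (φ θ))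
    + ∫ θ in (-h)..(0:ℝ), (w1 + (h + θ) * w2) * hnorm n r p (φ θ) ^ (γ + μ)

noncomputable def segNorm (n : ℕ) (r : Fin n → ℝ) (p h : ℝ)
    (x : ℝ → Fin n → ℝ) (t : ℝ) : ℝ :=
  sSup ((fun θ => hnorm n r p (x (t + θ))) '' Set.Icc (-h) 0)

def IsSol (n : ℕ) (h : ℝ) (f : (Fin n → ℝ) → (Fin n → ℝ) → (Fin n → ℝ))
    (x : ℝ → Fin n → ℝ) : Prop :=
  ContinuousOn x (Set.Ici (-h)) ∧
  ∀ t : ℝ, 0 ≤ t → HasDerivWithinAt x (f (x t) (x (t - h))) (Set.Ici 0) t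

theorem hnorm_nonneg (n : ℕ) (r : Fin n → ℝ) (p : ℝ) (x : Fin n → ℝ) : 0 ≤ hnorm n r p x :=
  Real.rpow_nonneg (Finset.sum_nonneg fun _ _ => Real.rpow_nonneg (abs_nonneg _) _) _

theorem continuous_hnorm (n : ℕ) (r : Fin n → ℝ) (hr : ∀ i, 0 < r i) (p : ℝ) (hp : 0 < p) :
    Continuous (hnorm n r p) := by
  unfold hnorm
  refine Continuous.rpow_const (continuous_finsetSum _ fun i _ => ?_) fun _ => Or.inr (by positivity)
  exact (continuous_apply i).abs.rpow_const fun _ => Or.inr (div_pos hp (hr i)).le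

theorem rpow_add_le_mul_rpow {b δ γ μ : ℝ} (hb : 0 ≤ b) (hbδ : b ≤ δ) (hγ : 0 < γ) (hμ : 0 < μ) :
    b ^ (γ + μ) ≤ δ ^ μ * b ^ γ := by
  rw [Real.rpow_add_of_nonneg hb hγ.le hμ.le, mul_comm]
  gcongr

/-- Weighted product bound used for the cross term of the functional. -/
theorem rpow_sub_mul_rpow_add_le {a b δ γ μ r : ℝ} (ha : 0 ≤ a) (hb : 0 ≤ b)
    (haδ : a ≤ δ) (hbδ : b ≤ δ) (hr : 0 < r) (hγ : r ≤ γ) (hμ : 0 < μ) :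
    a ^ (γ - r) * (a ^ (μ + r) + b ^ (μ + r)) ≤ δ ^ μ * (2 * a ^ γ + b ^ γ) := by
  have hγ0 : 0 < γ := hr.trans_le hγ
  have hγr : 0 ≤ γ - r := sub_nonneg.2 hγ
  have hsplit : ∀ c : ℝ, 0 ≤ c → c ^ (γ - r) * c ^ r = c ^ γ := fun c hc => by
    rw [← Real.rpow_add_of_nonneg hc hγr hr.le, sub_add_cancel]
  have hdiag : a ^ (γ - r) * a ^ (μ + r) ≤ δ ^ μ * a ^ γ := by
    rw [← Real.rpow_add_of_nonneg ha hγr (by positivity),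
      show γ - r + (μ + r) = γ + μ by ring]
    exact rpow_add_le_mul_rpow ha haδ hγ0 hμ
  have hprod : a ^ (γ - r) * b ^ r ≤ a ^ γ + b ^ γ := by
    rcases le_total a b with hab | hab
    · calc a ^ (γ - r) * b ^ r ≤ b ^ (γ - r) * b ^ r := by gcongr
        _ = b ^ γ := hsplit b hb
        _ ≤ a ^ γ + b ^ γ := le_add_of_nonneg_left (by positivity)
    · calc a ^ (γ - r) * b ^ r ≤ a ^ (γ - r) * a ^ r := by gcongr
        _ = a ^ γ := hsplit a ha
        _ ≤ a ^ γ + b ^ γ := le_add_of_nonneg_right (by positivity)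
  have hcross : a ^ (γ - r) * b ^ (μ + r) ≤ δ ^ μ * (a ^ γ + b ^ γ) := by
    rw [Real.rpow_add_of_nonneg hb hμ.le hr.le]
    calc a ^ (γ - r) * (b ^ μ * b ^ r) = b ^ μ * (a ^ (γ - r) * b ^ r) := by ring
      _ ≤ δ ^ μ * (a ^ γ + b ^ γ) := by
        have : 0 ≤ δ := ha.trans haδ
        gcongr
  linarith

theorem ContinuousLinearMap.apply_le_sum_mul {n : ℕ} (L : (Fin n → ℝ) →L[ℝ] ℝ) (x B C : Fin n → ℝ)
    (hL : ∀ i, |L (Pi.single i 1)| ≤ B i) (hx : ∀ i, |x i| ≤ C i) :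
    L x ≤ ∑ i, B i * C i := by
  rw [← L.coe_coe, (L : (Fin n → ℝ) →ₗ[ℝ] ℝ).pi_apply_eq_sum_univ x, L.coe_coe]
  refine Finset.sum_le_sum fun i _ => ?_
  rw [smul_eq_mul, mul_comm]
  refine (le_abs_self _).trans ?_
  rw [abs_mul]
  have hsingle : (fun j => if i = j then (1 : ℝ) else 0) = Pi.single i 1 := by
    ext j
    simp [Pi.single_apply, eq_comm]
  rw [hsingle]
  exact mul_le_mul (hL i) (hx i) (abs_nonneg _) ((abs_nonneg _).trans (hL i))

theorem stmt5
    (n : ℕ) (hn : 1 ≤ n) (r : Fin n → ℝ) (hr : ∀ i, 0 < r i) (p : ℝ) (hp : 1 ≤ p)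
    (h μ : ℝ) (hh : 0 < h) (hμ : 0 < μ)
    (f : (Fin n → ℝ) → (Fin n → ℝ) → (Fin n → ℝ))
    (hf_cont : Continuous fun q : (Fin n → ℝ) × (Fin n → ℝ) => f q.1 q.2)
    (hf_hom : ∀ ε : ℝ, 0 < ε → ∀ x y : Fin n → ℝ, ∀ i,
      f (fun k => ε ^ r k * x k) (fun k => ε ^ r k * y k) i = ε ^ (μ + r i) * f x y i)
    (m : Fin n → ℝ) (hm : ∀ i, 0 < m i)
    (hfm : ∀ x y : Fin n → ℝ, ∀ i,
      |f x y i| ≤ m i * (hnorm n r p x ^ (μ + r i) + hnorm n r p y ^ (μ + r i)))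
    (V : (Fin n → ℝ) → ℝ) (hV : ContDiff ℝ 1 V)
    (α1 γ : ℝ) (hα1 : 0 < α1) (hγ : ∀ i, 2 * r i ≤ γ)
    (hVub : ∀ x : Fin n → ℝ, V x ≤ α1 * hnorm n r p x ^ γ)
    (β : Fin n → ℝ) (hβ : ∀ i, 0 < β i)
    (hVd : ∀ x : Fin n → ℝ, ∀ i,
      |fderiv ℝ V x (Pi.single i 1)| ≤ β i * hnorm n r p x ^ (γ - r i))
    (w1 w2 : ℝ) (hw1 : 0 < w1) (hw2 : 0 < w2)
    :
    ∀ δ : ℝ, 0 < δ → ∀ φ : ℝ → Fin n → ℝ, ContinuousOn φ (Set.Icc (-h) 0) →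
      (∀ θ ∈ Set.Icc (-h) (0:ℝ), hnorm n r p (φ θ) ≤ δ) →
      vfun n r p h μ γ w1 w2 f V φ
        ≤ (α1 + 2 * h * (∑ i, β i * m i) * δ ^ μ) * hnorm n r p (φ 0) ^ γ
          + ((w1 + h * w2 + ∑ i, β i * m i) * δ ^ μ) * ∫ θ in (-h)..(0:ℝ), hnorm n r p (φ θ) ^ γ := by
  intro δ hδ φ hφ hφδ
  have hγ0 : 0 < γ := by linarith [hγ ⟨0, hn⟩, hr ⟨0, hn⟩]
  have hle : -h ≤ (0 : ℝ) := by linarith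
  have h0 : (0 : ℝ) ∈ Set.Icc (-h) 0 := ⟨hle, le_rfl⟩
  have hnn := hnorm_nonneg n r p
  have hN : ContinuousOn (fun θ => hnorm n r p (φ θ)) (Set.uIcc (-h) 0) := by
    rw [Set.uIcc_of_le hle]
    exact (continuous_hnorm n r hr p (by linarith)).comp_continuousOn hφ
  have hF : ContinuousOn (fun θ => f (φ 0) (φ θ)) (Set.uIcc (-h) 0) := by
    rw [Set.uIcc_of_le hle]
    exact hf_cont.comp_continuousOn (continuousOn_const.prodMk hφ)
  have hNγ : IntervalIntegrable (fun θ => hnorm n r p (φ θ) ^ γ) MeasureTheory.volume (-h) 0 :=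
    (hN.rpow_const fun _ _ => Or.inr hγ0.le).intervalIntegrable
  have hNγμ : IntervalIntegrable
      (fun θ => (w1 + (h + θ) * w2) * hnorm n r p (φ θ) ^ (γ + μ)) MeasureTheory.volume (-h) 0 :=
    ((by fun_prop : Continuous fun θ : ℝ => w1 + (h + θ) * w2).continuousOn.mul
      (hN.rpow_const fun _ _ => Or.inr (by positivity))).intervalIntegrable
  set L := fderiv ℝ V (φ 0)
  set a := hnorm n r p (φ 0)
  set S := ∑ i, β i * m i
  have hpoint : ∀ θ ∈ Set.Icc (-h) (0 : ℝ),
      L (f (φ 0) (φ θ)) ≤ S * δ ^ μ * (2 * a ^ γ) + S * δ ^ μ * hnorm n r p (φ θ) ^ γ := by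
    intro θ hθ
    refine (L.apply_le_sum_mul _ _ _ (hVd (φ 0)) (hfm (φ 0) (φ θ))).trans ?_
    rw [← mul_add, mul_assoc, Finset.sum_mul]
    refine Finset.sum_le_sum fun i _ => ?_
    rw [mul_mul_mul_comm]
    exact mul_le_mul_of_nonneg_left
      (rpow_sub_mul_rpow_add_le (hnn _) (hnn _) (hφδ 0 h0) (hφδ θ hθ) (hr i)
        (by linarith [hγ i, hr i]) hμ) (mul_pos (hβ i) (hm i)).le
  have hgrad : L (∫ θ in (-h)..(0:ℝ), f (φ 0) (φ θ)) ≤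
      h * (S * δ ^ μ * (2 * a ^ γ)) +
        S * δ ^ μ * ∫ θ in (-h)..(0:ℝ), hnorm n r p (φ θ) ^ γ := by
    rw [← L.intervalIntegral_comp_comm hF.intervalIntegrable]
    refine (intervalIntegral.integral_mono_on hle
      (L.continuous.comp_continuousOn hF).intervalIntegrable
      (intervalIntegrable_const.add (hNγ.const_mul _)) hpoint).trans_eq ?_
    rw [intervalIntegral.integral_add intervalIntegrable_const (hNγ.const_mul _),
      intervalIntegral.integral_const, intervalIntegral.integral_const_mul]
    simp
  have hweight : ∫ θ in (-h)..(0:ℝ), (w1 + (h + θ) * w2) * hnorm n r p (φ θ) ^ (γ + μ) ≤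
      (w1 + h * w2) * δ ^ μ * ∫ θ in (-h)..(0:ℝ), hnorm n r p (φ θ) ^ γ := by
    rw [← intervalIntegral.integral_const_mul]
    refine intervalIntegral.integral_mono_on hle hNγμ (hNγ.const_mul _) fun θ hθ => ?_
    rw [mul_assoc]
    refine mul_le_mul ?_ (rpow_add_le_mul_rpow (hnn _) (hφδ θ hθ) hγ0 hμ)
      (Real.rpow_nonneg (hnn _) _) (by positivity)
    have := mul_le_mul_of_nonneg_right (show h + θ ≤ h by linarith [hθ.2]) hw2.le
    linarith
  have hVa := hVub (φ 0)
  change V (φ 0) + L _ + _ ≤ _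
  linarith
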